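/- Let I=(φ,τ) be a QBF and let x be the last variable of the prefix τ. If x is existentially quantified, then I is true if and only if res(I,x) is true. -/

import Mathlib

/-! Basic definitions for quantified Boolean formulas (QBF). -/

abbrev Var := ℕ
/-- A literal is a variable together with a polarity (`true` = positive). -/
abbrev Lit := Var × Bool
/-- A clause is a finite set of literals. -/
abbrev Clause := Finset Lit
/-- A CNF formula is a finite set of clauses. -/
abbrev CNF := Finset Clause

/-- Quantifiers. -/
inductive Quant : Type
  | ex : Quant
  | univ : Quant
deriving DecidableEq

/-- A prefix is a sequence of quantified variables. -/
abbrev QPrefix := List (Var × Quant)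

/-- The set of variables occurring in a clause. -/
def clauseVars (C : Clause) : Finset Var := C.image Prod.fst

/-- The set of variables occurring in a CNF formula. -/
def cnfVars (φ : CNF) : Finset Var := φ.sup clauseVars

/-- Recursive semantics of a quantified CNF along a prefix, carrying the assignment `σ`
built so far.  `A` is the set of variables bound by the (whole, original) prefix;
a literal whose variable was never bound by the prefix cannot be evaluated and is
treated as satisfied. -/
def QTrueAux (A : Finset Var) (φ : CNF) : QPrefix → (Var → Bool) → Prop
  | [], σ => ∀ C ∈ φ, ∃ l ∈ C, l.1 ∉ A ∨ σ l.1 = l.2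
  | (x, Quant.ex) :: τ, σ => ∃ b : Bool, QTrueAux A φ τ (Function.update σ x b)
  | (x, Quant.univ) :: τ, σ => ∀ b : Bool, QTrueAux A φ τ (Function.update σ x b)

/-- Truth of the QBF `(φ, τ)` under the usual recursive semantics. -/
def QTrue (φ : CNF) (τ : QPrefix) : Prop :=
  QTrueAux (τ.map Prod.fst).toFinset φ τ (fun _ => false)

/-- `res(I,x)`:  all clauses containing `x` or `x̄` are replaced by the pairwise
resolvents `(D ∖ {x}) ∪ (C ∖ {x̄})` for `D ∋ x`, `C ∋ x̄`. -/
def resolve (φ : CNF) (x : Var) : CNF :=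
  (φ \ ((φ.filter fun C => (x, true) ∈ C) ∪ (φ.filter fun C => (x, false) ∈ C))) ∪
    ((φ.filter fun C => (x, true) ∈ C) ×ˢ (φ.filter fun C => (x, false) ∈ C)).image
      (fun p => p.1.erase (x, true) ∪ p.2.erase (x, false))

/-- `I ∖ x` : delete all occurrences of the literals `x` and `x̄` from all clauses. -/
def removeVar (φ : CNF) (x : Var) : CNF :=
  φ.image fun C => (C.erase (x, true)).erase (x, false)

/-- Membership in `resolve φ x`: either an untouched clause or a resolvent. -/
theorem mem_resolve {φ : CNF} {x : Var} {E : Clause} :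
    E ∈ resolve φ x ↔
      (E ∈ φ ∧ (x, true) ∉ E ∧ (x, false) ∉ E) ∨
      ∃ D ∈ φ, (x, true) ∈ D ∧ ∃ C ∈ φ, (x, false) ∈ C ∧
        D.erase (x, true) ∪ C.erase (x, false) = E := by
  simp only [resolve, Finset.mem_union, Finset.mem_sdiff, Finset.mem_filter, Finset.mem_image,
    Finset.mem_product, Prod.exists]
  grind

/-- If a clause is satisfied after setting `x` to `b`, and the literal of `x` with polarity `!b`
is removed, the remaining clause is satisfied once `x` is unbound. -/
theorem exists_sat_erase {A : Finset Var} {x : Var} (hx : x ∉ A) {σ : Var → Bool} {b : Bool}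
    {C : Clause}
    (h : ∃ l ∈ C, l.1 ∉ insert x A ∨ Function.update σ x b l.1 = l.2) :
    ∃ l ∈ C.erase (x, !b), l.1 ∉ A ∨ σ l.1 = l.2 := by
  obtain ⟨⟨v, c⟩, hl, h⟩ := h
  refine ⟨(v, c), ?_, ?_⟩ <;> by_cases hv : v = x
  · subst hv
    simp_all
  · simp_all
  · simp_all
  · simp_all

/-- If a clause fails after setting `x` to `b`, then it avoids the literal of `x` with
polarity `b`, and every literal on another variable is bound and false. -/
theorem not_sat_update {A : Finset Var} {x : Var} {σ : Var → Bool} {b : Bool} {C : Clause}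
    (h : ¬ ∃ l ∈ C, l.1 ∉ insert x A ∨ Function.update σ x b l.1 = l.2) :
    (x, b) ∉ C ∧ ∀ l ∈ C, l.1 ≠ x → ¬ (l.1 ∉ A ∨ σ l.1 = l.2) := by
  push Not at h
  refine ⟨fun hb => (h _ hb).2 (by simp), fun l hl hlx => ?_⟩
  have := h l hl
  simp_all

/-- Resolution on the innermost existential variable is correct for a fixed assignment to the
remaining variables. -/
theorem qTrueAux_resolve_nil {A : Finset Var} (φ : CNF) {x : Var} (hx : x ∉ A) (σ : Var → Bool) :
    (∃ b, QTrueAux (insert x A) φ [] (Function.update σ x b)) ↔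
      QTrueAux A (resolve φ x) [] σ := by
  simp only [QTrueAux]
  constructor
  · rintro ⟨b, h⟩ E hE
    rcases mem_resolve.1 hE with ⟨hφ, -, -⟩ | ⟨D, hD, -, C, hC, -, rfl⟩
    · obtain ⟨l, hl, hs⟩ := exists_sat_erase hx (h E hφ)
      exact ⟨l, Finset.mem_of_mem_erase hl, hs⟩
    · cases b
      · obtain ⟨l, hl, hs⟩ := exists_sat_erase hx (h D hD)
        exact ⟨l, Finset.mem_union_left _ hl, hs⟩
      · obtain ⟨l, hl, hs⟩ := exists_sat_erase hx (h C hC)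
        exact ⟨l, Finset.mem_union_right _ hl, hs⟩
  · intro h
    have key : ∀ {b : Bool} {C : Clause}, C ∈ φ →
        (¬ ∃ l ∈ C, l.1 ∉ insert x A ∨ Function.update σ x b l.1 = l.2) → (x, !b) ∈ C := by
      intro b C hC hf
      obtain ⟨hb, hl⟩ := not_sat_update hf
      by_contra hnb
      obtain ⟨l, hlC, hs⟩ := h C (mem_resolve.2 (Or.inl ⟨hC, by cases b <;> simp_all⟩))
      refine hl l hlC ?_ hs
      rintro rfl
      obtain ⟨v, c⟩ := l
      cases b <;> cases c <;> simp_all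
    by_contra hcon
    have hfail : ∀ b : Bool, ∃ C ∈ φ,
        ¬ ∃ l ∈ C, l.1 ∉ insert x A ∨ Function.update σ x b l.1 = l.2 := by
      intro b
      by_contra hb
      exact hcon ⟨b, fun C hC => by_contra fun hf => hb ⟨C, hC, hf⟩⟩
    obtain ⟨D, hD, hDf⟩ := hfail false
    obtain ⟨C, hC, hCf⟩ := hfail true
    obtain ⟨l, hl, hs⟩ := h _ (mem_resolve.2 (Or.inr ⟨D, hD, key hD hDf, C, hC, key hC hCf, rfl⟩))
    obtain ⟨hxD, hDl⟩ := not_sat_update hDf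
    obtain ⟨hxC, hCl⟩ := not_sat_update hCf
    obtain ⟨v, c⟩ := l
    rcases Finset.mem_union.1 hl with hl | hl <;> obtain ⟨hne, hl⟩ := Finset.mem_erase.1 hl
    · refine hDl _ hl ?_ hs
      rintro rfl
      cases c <;> simp_all
    · refine hCl _ hl ?_ hs
      rintro rfl
      cases c <;> simp_all

/-- Resolution on the innermost existential variable is correct under any outer prefix. -/
theorem qTrueAux_resolve {A : Finset Var} (φ : CNF) {x : Var} (hx : x ∉ A) (τ : QPrefix)
    (σ : Var → Bool) :
    QTrueAux (insert x A) φ (τ ++ [(x, Quant.ex)]) σ ↔ QTrueAux A (resolve φ x) τ σ := by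
  induction τ generalizing σ with
  | nil => exact qTrueAux_resolve_nil φ hx σ
  | cons p τ ih =>
    obtain ⟨y, _ | _⟩ := p
    · exact exists_congr fun b => ih _
    · exact forall_congr' fun b => ih _

/-- Let `I = (φ, τ·∃x)` be a QBF whose last prefix variable `x` is
existentially quantified.  Then `I` is true if and only if `res(I, x)` is true. -/
theorem qtrue_resolve_iff (φ : CNF) (τ : QPrefix) (x : Var)
    (hnodup : ((τ ++ [(x, Quant.ex)]).map Prod.fst).Nodup)
    (hvars : ∀ v ∈ cnfVars φ, v ∈ (τ ++ [(x, Quant.ex)]).map Prod.fst) :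
    QTrue φ (τ ++ [(x, Quant.ex)]) ↔ QTrue (resolve φ x) τ := by
  have hx : x ∉ (τ.map Prod.fst).toFinset := by
    rw [List.map_append, List.nodup_append] at hnodup
    intro h
    exact hnodup.2.2 x (List.mem_toFinset.1 h) x (by simp) rfl
  have hA : ((τ ++ [(x, Quant.ex)]).map Prod.fst).toFinset =
      insert x (τ.map Prod.fst).toFinset := by
    ext v
    simp
  rw [QTrue, QTrue, hA]
  exact qTrueAux_resolve φ hx τ _
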